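/- Let μ ∈ ℂ with μ ≠ 0, and let M₁ and M₂ be the 5×5 complex matrices defined in the context. Set M₃ := (1/(8μ))·⁅M₁, M₂⁆. Then ⁅M₁, M₃⁆ = −M₁ and ⁅M₂, M₃⁆ = M₂. (These relations exhibit the Lie algebra associated to the second variational equation of Painlevé III, with parameters (2μ−1, −2μ+1, 1, −1), along y = 1 as sl₂ in a 5-dimensional representation.) -/

import Mathlib

noncomputable def M₁ (μ : ℂ) : Matrix (Fin 5) (Fin 5) ℂ :=
  !![0, 1, 0, 0, 0;
     0, 0, 2, 0, 0;
     0, 0, 0, 0, 0;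
     -4 * μ ^ 2, 2 * μ, 0, 0, 1;
     0, 4 * μ ^ 2, -2 * μ, 0, 0]

noncomputable def M₂ (μ : ℂ) : Matrix (Fin 5) (Fin 5) ℂ :=
  !![0, 0, 0, 0, 0;
     8 * μ, 0, 0, 0, 0;
     0, 4 * μ, 0, 0, 0;
     0, -1, 0, 0, 0;
     -12 * μ ^ 2, 0, 1, 4 * μ, 0]

theorem inv_smul_lie_M₁_M₂ {μ : ℂ} (hμ : μ ≠ 0) :
    (8 * μ)⁻¹ • ⁅M₁ μ, M₂ μ⁆ =
      !![1, 0, 0, 0, 0;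
         0, 0, 0, 0, 0;
         0, 0, -1, 0, 0;
         μ / 2, 0, 3 / (8 * μ), 1 / 2, 0;
         6 * μ ^ 2, -μ / 2, 0, 0, -1 / 2] := by
  ext i j
  fin_cases i <;> fin_cases j <;> simp [M₁, M₂, Ring.lie_def] <;> field_simp <;>
    first | ring1 | norm_num

/-- With `M₃ = (1/(8μ))⁅M₁,M₂⁆`, one has `⁅M₁,M₃⁆ = −M₁` and `⁅M₂,M₃⁆ = M₂`: the Lie
algebra associated to the second variational equation of Painlevé III along `y = 1` is
`sl₂` in a 5-dimensional representation. -/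
theorem stmt_13 (μ : ℂ) (hμ : μ ≠ 0) :
    ⁅M₁ μ, (8 * μ)⁻¹ • ⁅M₁ μ, M₂ μ⁆⁆ = -(M₁ μ) ∧
    ⁅M₂ μ, (8 * μ)⁻¹ • ⁅M₁ μ, M₂ μ⁆⁆ = M₂ μ := by
  rw [inv_smul_lie_M₁_M₂ hμ]
  constructor <;> ext i j <;> fin_cases i <;> fin_cases j <;>
    simp [M₁, M₂, Ring.lie_def] <;> field_simp <;> ring
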